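/- arXiv:2304.01766 — 2 statements merged into one kernel-verified Lean document; each statement's English description precedes it below -/
import Mathlib

section
/- Let h > 0 and let x0, x1 ∈ ℝⁿ satisfy one step of the discrete gradient method (x1 − x0)/h = (J̄ − R̄)·∇̄H(x0, x1) + B̄·ū with output y1 = B̄ᵀ·∇̄H(x0, x1), where ∇̄H is a discrete gradient of H, J̄ is skew-symmetric and R̄ is symmetric positive semi-definite. Then the discrete energy balance H(x1) − H(x0) = −h·∇̄H(x0, x1)ᵀ R̄ ∇̄H(x0, x1) + h·y1ᵀ ū holds. -/
open Matrix

/-- The quadratic form of a skew-symmetric real matrix vanishes. -/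
theorem dotProduct_mulVec_self_eq_zero_of_transpose_eq_neg {ι : Type*} [Fintype ι]
    {A : Matrix ι ι ℝ} (hA : Aᵀ = -A) (v : ι → ℝ) : v ⬝ᵥ (A *ᵥ v) = 0 := by
  have key : v ⬝ᵥ (A *ᵥ v) = -(v ⬝ᵥ (A *ᵥ v)) := by
    conv_lhs => rw [dotProduct_mulVec, ← mulVec_transpose, hA, neg_mulVec, neg_dotProduct,
      dotProduct_comm]
  linarith

/-- **Discrete energy balance of the discrete gradient method.**
If `x1` results from `x0` by one step of size `h > 0` of the discrete gradient method
`(x1 − x0)/h = (J̄ − R̄) ∇̄H(x0, x1) + B̄ ū`, `y1 = B̄ᵀ ∇̄H(x0, x1)`, where `∇̄H` is a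
discrete gradient of `H`, `J̄` is skew-symmetric and `R̄` is symmetric positive
semi-definite, then
`H(x1) − H(x0) = −h ∇̄H(x0,x1)ᵀ R̄ ∇̄H(x0,x1) + h y1ᵀ ū`. -/
theorem discrete_gradient_energy_balance
    {n d : ℕ} (h : ℝ) (hh : 0 < h)
    (H : (Fin n → ℝ) → ℝ) (gradH : (Fin n → ℝ) → (Fin n → ℝ))
    (dH : (Fin n → ℝ) → (Fin n → ℝ) → (Fin n → ℝ))
    (Jbar Rbar : Matrix (Fin n) (Fin n) ℝ)
    (Bbar : Matrix (Fin n) (Fin d) ℝ) (ubar : Fin d → ℝ)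
    (x0 x1 : Fin n → ℝ) (y1 : Fin d → ℝ)
    -- discrete gradient property (i)
    (hdH1 : ∀ x y, dH x y ⬝ᵥ (y - x) = H y - H x)
    -- discrete gradient property (ii)
    (hdH2 : ∀ x, dH x x = gradH x)
    -- J̄ is skew-symmetric
    (hJ : Jbarᵀ = -Jbar)
    -- R̄ is symmetric positive semi-definite
    (hR : Rbar.PosSemidef)
    -- one step of the discrete gradient method
    (hstep : h⁻¹ • (x1 - x0) = (Jbar - Rbar) *ᵥ dH x0 x1 + Bbar *ᵥ ubar)
    -- output equation
    (hy : y1 = Bbarᵀ *ᵥ dH x0 x1) :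
    H x1 - H x0 = -(h * (dH x0 x1 ⬝ᵥ (Rbar *ᵥ dH x0 x1))) + h * (y1 ⬝ᵥ ubar) := by
  have hx : x1 - x0 = h • ((Jbar - Rbar) *ᵥ dH x0 x1 + Bbar *ᵥ ubar) := by
    rw [← hstep, smul_inv_smul₀ hh.ne']
  have hB : dH x0 x1 ⬝ᵥ (Bbar *ᵥ ubar) = y1 ⬝ᵥ ubar := by
    rw [hy, mulVec_transpose, dotProduct_mulVec]
  rw [← hdH1, hx, dotProduct_smul, dotProduct_add, sub_mulVec, dotProduct_sub,
    dotProduct_mulVec_self_eq_zero_of_transpose_eq_neg hJ, hB, smul_eq_mul]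
  ring
end

section
/- Let h > 0 and let x0, x1 ∈ ℝⁿ satisfy one step of the discrete gradient method (x1 − x0)/h = (J̄ − R̄)·∇̄H(x0, x1) + B̄·ū with output y1 = B̄ᵀ·∇̄H(x0, x1), where ∇̄H is a discrete gradient of H, J̄ is skew-symmetric and R̄ is symmetric positive semi-definite. Then the discrete dissipativity inequality H(x1) − H(x0) ≤ h·y1ᵀ ū holds; in particular, if ū = 0 then H(x1) ≤ H(x0). -/
open Matrix

/-- The quadratic form of a skew-symmetric real matrix vanishes. -/
theorem dotProduct_mulVec_self_of_transpose_eq_neg {ι : Type*} [Fintype ι]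
    {J : Matrix ι ι ℝ} (hJ : Jᵀ = -J) (v : ι → ℝ) : v ⬝ᵥ (J *ᵥ v) = 0 := by
  have h : v ⬝ᵥ (J *ᵥ v) = -(v ⬝ᵥ (J *ᵥ v)) := by
    conv_lhs => rw [dotProduct_mulVec, ← mulVec_transpose, hJ, neg_mulVec, neg_dotProduct,
      dotProduct_comm]
  linarith

/-- **Discrete dissipativity inequality of the discrete gradient method.**
If `x1` results from `x0` by one step of size `h > 0` of the discrete gradient method
`(x1 − x0)/h = (J̄ − R̄) ∇̄H(x0, x1) + B̄ ū`, `y1 = B̄ᵀ ∇̄H(x0, x1)`, where `∇̄H` is a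
discrete gradient of `H`, `J̄` is skew-symmetric and `R̄` is symmetric positive
semi-definite, then `H(x1) − H(x0) ≤ h y1ᵀ ū`; in particular, if `ū = 0` then
`H(x1) ≤ H(x0)`. -/
theorem discrete_gradient_dissipativity
    {n d : ℕ} (h : ℝ) (hh : 0 < h)
    (H : (Fin n → ℝ) → ℝ) (gradH : (Fin n → ℝ) → (Fin n → ℝ))
    (dH : (Fin n → ℝ) → (Fin n → ℝ) → (Fin n → ℝ))
    (Jbar Rbar : Matrix (Fin n) (Fin n) ℝ)
    (Bbar : Matrix (Fin n) (Fin d) ℝ) (ubar : Fin d → ℝ)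
    (x0 x1 : Fin n → ℝ) (y1 : Fin d → ℝ)
    -- discrete gradient property (i)
    (hdH1 : ∀ x y, dH x y ⬝ᵥ (y - x) = H y - H x)
    -- discrete gradient property (ii)
    (hdH2 : ∀ x, dH x x = gradH x)
    -- J̄ is skew-symmetric
    (hJ : Jbarᵀ = -Jbar)
    -- R̄ is symmetric positive semi-definite
    (hR : Rbar.PosSemidef)
    -- one step of the discrete gradient method
    (hstep : h⁻¹ • (x1 - x0) = (Jbar - Rbar) *ᵥ dH x0 x1 + Bbar *ᵥ ubar)
    -- output equation
    (hy : y1 = Bbarᵀ *ᵥ dH x0 x1) :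
    H x1 - H x0 ≤ h * (y1 ⬝ᵥ ubar) ∧ (ubar = 0 → H x1 ≤ H x0) := by
  have hx : x1 - x0 = h • ((Jbar - Rbar) *ᵥ dH x0 x1 + Bbar *ᵥ ubar) := by
    rw [← hstep, smul_inv_smul₀ hh.ne']
  have hRnonneg : 0 ≤ dH x0 x1 ⬝ᵥ (Rbar *ᵥ dH x0 x1) := by
    simpa using hR.dotProduct_mulVec_nonneg (dH x0 x1)
  have hB : dH x0 x1 ⬝ᵥ (Bbar *ᵥ ubar) = y1 ⬝ᵥ ubar := by
    rw [hy, mulVec_transpose, dotProduct_mulVec]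
  have hdiss : H x1 - H x0 ≤ h * (y1 ⬝ᵥ ubar) := by
    rw [← hdH1, hx, dotProduct_smul, smul_eq_mul, dotProduct_add, sub_mulVec, dotProduct_sub,
      dotProduct_mulVec_self_of_transpose_eq_neg hJ, hB]
    exact mul_le_mul_of_nonneg_left (by linarith) hh.le
  refine ⟨hdiss, fun hu => ?_⟩
  rw [hu, dotProduct_zero, mul_zero] at hdiss
  exact sub_nonpos.mp hdiss
end
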